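/- A temporal graph 𝒢 has temporal treewidth ttw(𝒢) ≤ 1 (i.e., its undirected static expansion is a forest) if and only if the underlying graph of 𝒢 is a forest and every edge of the underlying graph appears in exactly one time step. -/

import Mathlib

/-- The underlying graph of a temporal graph given by its layers: the union of all layers. -/
def underlying {V : Type} {τ : ℕ} (layers : Fin τ → SimpleGraph V) : SimpleGraph V :=
  ⨆ i, layers i

/-- The undirected static expansion of a temporal graph: vertices are vertex appearances
`(v, t)`, with layer edges `{(v,t),(w,t)}` for each temporal edge `({v,w},t)` and column
edges `{(v,t),(v,t+1)}`. -/
def expansion {V : Type} {τ : ℕ} (layers : Fin τ → SimpleGraph V) :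
    SimpleGraph (V × Fin τ) :=
  SimpleGraph.fromRel (fun p q =>
    (p.2 = q.2 ∧ (layers p.2).Adj p.1 q.1) ∨ (p.1 = q.1 ∧ (p.2 : ℕ) + 1 = (q.2 : ℕ)))

lemma reach_of_step {A : Type} {G : SimpleGraph A} (P : A → Prop)
    (h : ∀ a b, G.Adj a b → P a → P b) {x y : A} (hr : G.Reachable x y) (hx : P x) : P y := by
  obtain ⟨p⟩ := hr
  induction p with
  | nil => exact hx
  | cons hadj _ ih => exact ih (h _ _ hadj hx)

lemma underlying_adj {V : Type} {τ : ℕ} (layers : Fin τ → SimpleGraph V) (v w : V) :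
    (underlying layers).Adj v w ↔ ∃ t, (layers t).Adj v w := by
  simp [underlying]

lemma expansion_adj {V : Type} {τ : ℕ} (layers : Fin τ → SimpleGraph V) (v w : V) (s t : Fin τ) :
    (expansion layers).Adj (v, s) (w, t) ↔ (s = t ∧ (layers s).Adj v w) ∨
      (v = w ∧ ((s : ℕ) + 1 = t ∨ (t : ℕ) + 1 = s)) := by
  simp only [expansion, SimpleGraph.fromRel_adj]
  constructor
  · rintro ⟨_, (⟨h1, h2⟩ | ⟨h1, h2⟩) | (⟨h1, h2⟩ | ⟨h1, h2⟩)⟩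
    · exact Or.inl ⟨h1, h2⟩
    · exact Or.inr ⟨h1, Or.inl h2⟩
    · replace h1 : t = s := h1
      subst h1
      exact Or.inl ⟨rfl, h2.symm⟩
    · exact Or.inr ⟨h1.symm, Or.inr h2⟩
  · rintro (⟨h1, h2⟩ | ⟨h1, h2 | h2⟩)
    · refine ⟨?_, Or.inl (Or.inl ⟨h1, h2⟩)⟩
      intro h
      exact h2.ne (congrArg Prod.fst h)
    · refine ⟨?_, Or.inl (Or.inr ⟨h1, h2⟩)⟩
      intro h
      have : s = t := congrArg Prod.snd h
      subst this; omega
    · refine ⟨?_, Or.inr (Or.inr ⟨h1.symm, h2⟩)⟩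
      intro h
      have : s = t := congrArg Prod.snd h
      subst this; omega

/-- Columns stay connected after deleting a layer edge. -/
lemma column_reach {V : Type} {τ : ℕ} (layers : Fin τ → SimpleGraph V) {v w : V} (hvw : v ≠ w)
    (t : Fin τ) (a : V) (r s : Fin τ) :
    ((expansion layers).deleteEdges {s((v, t), (w, t))}).Reachable (a, r) (a, s) := by
  have key : ∀ (n : ℕ) (hn : n < τ),
      ((expansion layers).deleteEdges {s((v, t), (w, t))}).Reachable
        (a, ⟨0, by omega⟩) (a, ⟨n, hn⟩) := by
    intro n
    induction n with
    | zero => intro _; exact SimpleGraph.Reachable.refl _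
    | succ n ih =>
      intro hn
      refine (ih (by omega)).trans (SimpleGraph.Adj.reachable ?_)
      rw [SimpleGraph.deleteEdges_adj, expansion_adj]
      refine ⟨Or.inr ⟨rfl, Or.inl rfl⟩, ?_⟩
      simp only [Set.mem_singleton_iff, Sym2.eq_iff, Prod.mk.injEq]
      rintro (⟨⟨h1, _⟩, ⟨h2, _⟩⟩ | ⟨⟨h1, _⟩, ⟨h2, _⟩⟩)
      · exact hvw (h1.symm.trans h2)
      · exact hvw (h2.symm.trans h1)
  exact (key r.1 r.2).symm.trans (key s.1 s.2)

/-- a temporal graph has temporal treewidth at most 1, i.e. its undirected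
static expansion is a forest, iff its underlying graph is a forest and every edge of the
underlying graph appears in exactly one time step. -/
theorem expansion_acyclic_iff {V : Type} [Nonempty V] {τ : ℕ}
    (layers : Fin τ → SimpleGraph V)
    (hedge : ∃ (t : Fin τ) (v w : V), (layers t).Adj v w) :
    (expansion layers).IsAcyclic ↔
      ((underlying layers).IsAcyclic ∧
        ∀ v w : V, (underlying layers).Adj v w → ∃! t : Fin τ, (layers t).Adj v w) := by
  have bridge : ∀ {A : Type} (G : SimpleGraph A), G.IsAcyclic ↔
      ∀ a b, G.Adj a b → ¬ (G.deleteEdges {s(a, b)}).Reachable a b := by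
    intro A G
    rw [SimpleGraph.isAcyclic_iff_forall_adj_isBridge]
    simp only [SimpleGraph.isBridge_iff]
  rw [bridge, bridge]
  constructor
  · intro h
    have layer : ∀ (v w : V) (t : Fin τ), (layers t).Adj v w → ∀ r s,
        ¬ ((expansion layers).deleteEdges {s((v, t), (w, t))}).Reachable (v, r) (w, s) := by
      intro v w t hvw r s hr
      refine h (v, t) (w, t) ((expansion_adj ..).2 (Or.inl ⟨rfl, hvw⟩)) ?_
      exact (column_reach layers hvw.ne t v t r).trans
        (hr.trans (column_reach layers hvw.ne t w s t))
    constructor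
    · intro v w hvw hr
      obtain ⟨t, ht⟩ := (underlying_adj ..).1 hvw
      refine layer v w t ht t t ?_
      refine reach_of_step (fun a =>
        ((expansion layers).deleteEdges {s((v, t), (w, t))}).Reachable (v, t) (a, t))
        ?_ hr (SimpleGraph.Reachable.refl _)
      intro a b hab ha
      rw [SimpleGraph.deleteEdges_adj, underlying_adj] at hab
      obtain ⟨⟨s, hs⟩, hne⟩ := hab
      refine ha.trans ((column_reach layers ht.ne t a t s).trans
        (SimpleGraph.Reachable.trans (SimpleGraph.Adj.reachable ?_)
          (column_reach layers ht.ne t b s t)))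
      rw [SimpleGraph.deleteEdges_adj, expansion_adj]
      refine ⟨Or.inl ⟨rfl, hs⟩, fun he => hne ?_⟩
      simp only [Set.mem_singleton_iff, Sym2.eq_iff, Prod.mk.injEq] at he ⊢
      tauto
    · intro v w hvw
      obtain ⟨t, ht⟩ := (underlying_adj ..).1 hvw
      refine ⟨t, ht, fun s hs => ?_⟩
      by_contra hst
      refine layer v w t ht s s (SimpleGraph.Adj.reachable ?_)
      rw [SimpleGraph.deleteEdges_adj, expansion_adj]
      refine ⟨Or.inl ⟨rfl, hs⟩, fun he => hst ?_⟩
      simp only [Set.mem_singleton_iff, Sym2.eq_iff, Prod.mk.injEq] at he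
      tauto
  · rintro ⟨hac, huniq⟩
    have uniq : ∀ {v w s t}, (layers s).Adj v w → (layers t).Adj v w → s = t := by
      intro v w s t hs ht
      exact (huniq v w ((underlying_adj ..).2 ⟨s, hs⟩)).unique hs ht
    have col : ∀ (v : V) (t t' : Fin τ), (t : ℕ) + 1 = t' →
        ¬ ((expansion layers).deleteEdges {s((v, t), (v, t'))}).Reachable (v, t) (v, t') := by
      intro v t t' htt hr
      let H : SimpleGraph V := SimpleGraph.fromRel
        (fun a b => ∃ s, (layers s).Adj a b ∧ (a = v ∨ b = v → s ≤ t))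
      have hH : ∀ a b s, (layers s).Adj a b → (a = v ∨ b = v → s ≤ t) → H.Adj a b := by
        intro a b s hs hc
        exact (SimpleGraph.fromRel_adj _ _ _).2 ⟨hs.ne, Or.inl ⟨s, hs, hc⟩⟩
      have hH' : ∀ a b, H.Adj a b → ∃ s, (layers s).Adj a b ∧ (a = v ∨ b = v → s ≤ t) := by
        intro a b hab
        rcases (SimpleGraph.fromRel_adj _ _ _).1 hab with ⟨_, h | ⟨s, hs, hc⟩⟩
        · exact h
        · exact ⟨s, hs.symm, fun h => hc h.symm⟩
      have := reach_of_step (fun p : V × Fin τ => H.Reachable v p.1 ∧ (p.1 = v → p.2 ≤ t))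
        ?_ hr ⟨SimpleGraph.Reachable.refl _, fun _ => le_refl _⟩
      · have h2 := this.2 rfl
        simp only [Fin.le_def] at h2
        omega
      rintro ⟨a, r⟩ ⟨b, s⟩ hab ⟨hra, hca⟩
      rw [SimpleGraph.deleteEdges_adj, expansion_adj] at hab
      simp only at hra hca ⊢
      obtain ⟨⟨hrs, hl⟩ | ⟨hab, hrs⟩, hne⟩ := hab
      · subst hrs
        by_cases hb : b = v
        · subst hb
          refine ⟨SimpleGraph.Reachable.refl _, fun _ => ?_⟩
          by_contra hgt
          refine hac b a ((underlying_adj ..).2 ⟨r, hl.symm⟩) (hra.mono ?_)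
          intro x y hxy
          obtain ⟨q, hq, hqc⟩ := hH' x y hxy
          rw [SimpleGraph.deleteEdges_adj, underlying_adj]
          refine ⟨⟨q, hq⟩, fun he => hgt ?_⟩
          simp only [Set.mem_singleton_iff, Sym2.eq_iff] at he
          rcases he with ⟨rfl, rfl⟩ | ⟨rfl, rfl⟩
          · rw [uniq hl hq.symm]; exact hqc (Or.inl rfl)
          · rw [uniq hl hq]; exact hqc (Or.inr rfl)
        · refine ⟨hra.trans (hH a b r hl ?_).reachable, fun h => absurd h hb⟩
          rintro (h | h)
          · exact hca h
          · exact absurd h hb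
      · subst hab
        refine ⟨hra, fun hav => ?_⟩
        subst hav
        have h1 := hca rfl
        by_contra hgt
        apply hne
        simp only [Fin.le_def] at h1 hgt
        have e1 : r = t := Fin.ext (by omega)
        have e2 : s = t' := Fin.ext (by omega)
        rw [e1, e2]; rfl
    rintro ⟨v, t⟩ ⟨w, t'⟩ hadj hr
    rw [expansion_adj] at hadj
    rcases hadj with ⟨rfl, hl⟩ | ⟨rfl, h | h⟩
    · refine hac v w ((underlying_adj ..).2 ⟨t, hl⟩) ?_
      refine reach_of_step (fun p : V × Fin τ =>
        ((underlying layers).deleteEdges {s(v, w)}).Reachable v p.1) ?_ hr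
        (SimpleGraph.Reachable.refl _)
      rintro ⟨a, r⟩ ⟨b, s⟩ hab ha
      rw [SimpleGraph.deleteEdges_adj, expansion_adj] at hab
      obtain ⟨⟨rfl, hab⟩ | ⟨rfl, _⟩, hne⟩ := hab
      · refine ha.trans (SimpleGraph.Adj.reachable ?_)
        rw [SimpleGraph.deleteEdges_adj, underlying_adj]
        refine ⟨⟨r, hab⟩, fun he => hne ?_⟩
        simp only [Set.mem_singleton_iff, Sym2.eq_iff] at he
        rcases he with ⟨rfl, rfl⟩ | ⟨rfl, rfl⟩
        · rw [uniq hab hl]; rfl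
        · rw [uniq hab hl.symm]; exact Sym2.eq_swap
      · exact ha
    · exact col v t t' h hr
    · refine col v t' t h ?_
      rw [Sym2.eq_swap]
      exact hr.symm
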